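/- Let A, B ∈ ℂ^{n₁×n₁×n₃} with A† = A and B† = B (each tensor equals its own Moore–Penrose inverse), let k = max{ind(A), ind(B)}, and let A^{GD}, B^{GD} be GD inverses of A and B satisfying the GD equations with exponent k. If A ⋆ B = B ⋆ A, A^{GD} ⋆ A ⋆ B = B ⋆ A^{GD} ⋆ A, and B ⋆ B^{GD} ⋆ A^{GD} = A^{GD} ⋆ B ⋆ B^{GD}, then the GDMP inverse of A ⋆ B built from the GD inverse B^{GD} ⋆ A^{GD} satisfies (A⋆B)^{GD,†} = B^{GD,†} ⋆ A^{GD,†}, i.e., (B^{GD}⋆A^{GD}) ⋆ (A⋆B) ⋆ (A⋆B)† = (B^{GD}⋆B⋆B†) ⋆ (A^{GD}⋆A⋆A†). -/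

import Mathlib

open Matrix BigOperators

/-- A third-order complex tensor in `ℂ^{n₁ × n₂ × n₃}`, given by its frontal slices. -/
abbrev Tensor3 (n₁ n₂ n₃ : ℕ) := Fin n₃ → Matrix (Fin n₁) (Fin n₂) ℂ

/-- Mode-3 product of a tensor with an `n₃ × n₃` matrix: the slices of the result are the
indicated linear combinations of the slices of `A`. -/
noncomputable def mode3 {n₁ n₂ n₃ : ℕ} (M : Matrix (Fin n₃) (Fin n₃) ℂ) (A : Tensor3 n₁ n₂ n₃) :
    Tensor3 n₁ n₂ n₃ :=
  fun i => ∑ j, M i j • A j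

/-- The M-product `A ⋆_M B`: slice-wise matrix product in the transformed (hat) domain,
transformed back by `M⁻¹`. -/
noncomputable def mprod {n₁ n₂ l n₃ : ℕ} (M : Matrix (Fin n₃) (Fin n₃) ℂ)
    (A : Tensor3 n₁ n₂ n₃) (B : Tensor3 n₂ l n₃) : Tensor3 n₁ l n₃ :=
  mode3 M⁻¹ (fun i => mode3 M A i * mode3 M B i)

/-- The identity tensor: every slice of its mode-3 transform is the identity matrix. -/
noncomputable def idT (n₁ : ℕ) {n₃ : ℕ} (M : Matrix (Fin n₃) (Fin n₃) ℂ) : Tensor3 n₁ n₁ n₃ :=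
  mode3 M⁻¹ (fun _ => (1 : Matrix (Fin n₁) (Fin n₁) ℂ))

/-- Powers of a square tensor with respect to the M-product. -/
noncomputable def mpow {n₁ n₃ : ℕ} (M : Matrix (Fin n₃) (Fin n₃) ℂ) (A : Tensor3 n₁ n₁ n₃) :
    ℕ → Tensor3 n₁ n₁ n₃
  | 0 => idT n₁ M
  | k + 1 => mprod M (mpow M A k) A

/-- Conjugate transpose with respect to the M-product: slice-wise conjugate transpose in the
transformed domain. -/
noncomputable def ctrans {n₁ n₂ n₃ : ℕ} (M : Matrix (Fin n₃) (Fin n₃) ℂ) (A : Tensor3 n₁ n₂ n₃) :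
    Tensor3 n₂ n₁ n₃ :=
  mode3 M⁻¹ (fun i => (mode3 M A i)ᴴ)

/-- Index of a square complex matrix: the least `k ≥ 0` with `rank(B^k) = rank(B^{k+1})`. -/
noncomputable def matIndex {n : ℕ} (B : Matrix (Fin n) (Fin n) ℂ) : ℕ :=
  sInf {k : ℕ | (B ^ k).rank = (B ^ (k + 1)).rank}

/-- Index of a tensor: the maximum of the indices of the slices of its mode-3 transform. -/
noncomputable def tIndex {n₁ n₃ : ℕ} (M : Matrix (Fin n₃) (Fin n₃) ℂ)
    (A : Tensor3 n₁ n₁ n₃) : ℕ :=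
  Finset.univ.sup fun i => matIndex (mode3 M A i)

/-- `X` is a GD inverse of `A` with exponent `k`:
`A ⋆ X ⋆ A = A`, `X ⋆ A^{k+1} = A^k`, `A^{k+1} ⋆ X = A^k`. -/
def IsGD {n₁ n₃ : ℕ} (M : Matrix (Fin n₃) (Fin n₃) ℂ) (A X : Tensor3 n₁ n₁ n₃)
    (k : ℕ) : Prop :=
  mprod M (mprod M A X) A = A ∧
  mprod M X (mpow M A (k + 1)) = mpow M A k ∧
  mprod M (mpow M A (k + 1)) X = mpow M A k

/-- `X` is the Drazin inverse of `A` with exponent `k`. -/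
def IsDrazin {n₁ n₃ : ℕ} (M : Matrix (Fin n₃) (Fin n₃) ℂ) (A X : Tensor3 n₁ n₁ n₃)
    (k : ℕ) : Prop :=
  mprod M X (mpow M A (k + 1)) = mpow M A k ∧
  mprod M (mprod M X A) X = X ∧
  mprod M X A = mprod M A X

/-- `X` is the Moore–Penrose inverse of `A`. -/
def IsMP {n₁ n₃ : ℕ} (M : Matrix (Fin n₃) (Fin n₃) ℂ) (A X : Tensor3 n₁ n₁ n₃) : Prop :=
  mprod M (mprod M A X) A = A ∧
  mprod M (mprod M X A) X = X ∧
  ctrans M (mprod M A X) = mprod M A X ∧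
  ctrans M (mprod M X A) = mprod M X A

section Mode3

variable {n₁ n₂ n₃ : ℕ} {M : Matrix (Fin n₃) (Fin n₃) ℂ}

theorem mode3_mode3 (P Q : Matrix (Fin n₃) (Fin n₃) ℂ) (A : Tensor3 n₁ n₂ n₃) :
    mode3 P (mode3 Q A) = mode3 (P * Q) A := by
  funext i
  simp only [mode3, Matrix.mul_apply, Finset.smul_sum, Finset.sum_smul, smul_smul]
  exact Finset.sum_comm

theorem mode3_one (A : Tensor3 n₁ n₂ n₃) : mode3 1 A = A := by
  funext i
  simp [mode3, Matrix.one_apply, ite_smul]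

theorem mode3_mode3_inv (hM : IsUnit M) (A : Tensor3 n₁ n₂ n₃) :
    mode3 M (mode3 M⁻¹ A) = A := by
  rw [mode3_mode3, Matrix.mul_nonsing_inv _ ((Matrix.isUnit_iff_isUnit_det _).1 hM), mode3_one]

theorem mode3_injective (hM : IsUnit M) :
    Function.Injective (mode3 M : Tensor3 n₁ n₂ n₃ → Tensor3 n₁ n₂ n₃) := by
  refine Function.LeftInverse.injective (g := mode3 M⁻¹) fun A => ?_
  rw [mode3_mode3, Matrix.nonsing_inv_mul _ ((Matrix.isUnit_iff_isUnit_det _).1 hM), mode3_one]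

theorem mode3_mprod (hM : IsUnit M) (A B : Tensor3 n₁ n₁ n₃) :
    mode3 M (mprod M A B) = mode3 M A * mode3 M B :=
  mode3_mode3_inv hM _

theorem mode3_ctrans (hM : IsUnit M) (A : Tensor3 n₁ n₁ n₃) :
    mode3 M (ctrans M A) = star (mode3 M A) :=
  mode3_mode3_inv hM _

theorem mode3_mpow (hM : IsUnit M) (A : Tensor3 n₁ n₁ n₃) (k : ℕ) :
    mode3 M (mpow M A k) = mode3 M A ^ k := by
  induction k with
  | zero => exact mode3_mode3_inv hM _
  | succ k ih => rw [mpow, mode3_mprod hM, ih, pow_succ]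

end Mode3

section Monoid

variable {R : Type*} [Monoid R]

theorem pow_two_mul_add_one_of_mul_mul_self {a : R} (ha : a * a * a = a) (k : ℕ) :
    a ^ (2 * k + 1) = a := by
  induction k with
  | zero => simp
  | succ k ih =>
    rw [show 2 * (k + 1) + 1 = 2 * k + 1 + 1 + 1 by ring, pow_succ, pow_succ, ih, ha]

/-- A left inverse of a tripotent element on its powers satisfies `x * a = a * a`. -/
theorem mul_eq_mul_self_of_mul_pow {a x : R} {k : ℕ} (ha : a * a * a = a)
    (hx : x * a ^ (k + 1) = a ^ k) : x * a = a * a := by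
  have h : x * a = a ^ (2 * k) := by
    calc x * a = x * a ^ (2 * k + 1) := by rw [pow_two_mul_add_one_of_mul_mul_self ha]
      _ = x * a ^ (k + 1) * a ^ k := by rw [mul_assoc, ← pow_add]; congr 2; ring
      _ = a ^ (2 * k) := by rw [hx, ← pow_add]; congr 1; ring
  calc x * a = x * a * a * a := by rw [mul_assoc, mul_assoc, ← mul_assoc a a a, ha]
    _ = a ^ (2 * k + 1) * a := by rw [h, ← pow_succ]
    _ = a * a := by rw [pow_two_mul_add_one_of_mul_mul_self ha]

/-- If `c` is tripotent with self-adjoint square, then `c * z = c * c` for every `{1, 3}`-inverse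
`z` of `c`. -/
theorem mul_eq_mul_self_of_isSelfAdjoint [StarMul R] {c z : R} (hc : c * c * c = c)
    (hcc : star (c * c) = c * c) (hz : c * z * c = c) (hcz : star (c * z) = c * z) :
    c * z = c * c := by
  calc c * z = star (c * c * (c * z)) := by rw [← mul_assoc, hc, hcz]
    _ = c * z * c * c := by rw [star_mul, hcz, hcc, mul_assoc (c * z)]
    _ = c * c := by rw [hz]

theorem reverse_order_law_of_tripotent [StarMul R] {a b x y z : R} {k : ℕ}
    (ha : a * a * a = a) (haa : star (a * a) = a * a)
    (hb : b * b * b = b) (hbb : star (b * b) = b * b) (hab : a * b = b * a)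
    (hx : x * a ^ (k + 1) = a ^ k) (hy : y * b ^ (k + 1) = b ^ k)
    (hz : a * b * z * (a * b) = a * b) (habz : star (a * b * z) = a * b * z) :
    y * x * (a * b) * z = y * b * b * (x * a * a) := by
  have hab' : Commute a b := hab
  have hsq : a * b * (a * b) = a * a * (b * b) := by
    simpa only [mul_assoc] using congrArg (a * · * b) hab'.eq.symm
  have hsq' : Commute (a * a) (b * b) := (hab'.mul_left hab').mul_right (hab'.mul_left hab')
  have hxa := mul_eq_mul_self_of_mul_pow ha hx
  have hyb := mul_eq_mul_self_of_mul_pow hb hy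
  have hz' : a * b * z = a * b * (a * b) := by
    refine mul_eq_mul_self_of_isSelfAdjoint ?_ ?_ hz habz
    · calc a * b * (a * b) * (a * b) = a * a * (b * b * a) * b := by
            rw [hsq]; simp only [mul_assoc]
        _ = a * a * a * (b * b * b) := by
            rw [← (hab'.mul_right hab').eq]; simp only [mul_assoc]
        _ = a * b := by rw [ha, hb]
    · rw [hsq, star_mul, haa, hbb, hsq'.eq]
  calc y * x * (a * b) * z = y * (x * a * a * (b * b)) := by
        rw [mul_assoc _ _ z, hz', hsq]; simp only [mul_assoc]
    _ = y * b * b * a := by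
        rw [hxa, ha, (hab'.mul_right hab').eq]; simp only [mul_assoc]
    _ = y * b * b * (x * a * a) := by rw [hxa, ha]

end Monoid

/-- reverse order law for the GDMP inverse of involutory-MP tensors. -/
theorem gdmp_reverse_order_law {n₁ n₃ : ℕ} (hn₁ : 0 < n₁) (hn₃ : 0 < n₃)
    (M : Matrix (Fin n₃) (Fin n₃) ℂ) (hM : IsUnit M)
    (A B AGD BGD Adag Bdag ABdag : Tensor3 n₁ n₁ n₃) (k : ℕ)
    (hAdag : IsMP M A Adag) (hAA : Adag = A)
    (hBdag : IsMP M B Bdag) (hBB : Bdag = B)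
    (hk : k = max (tIndex M A) (tIndex M B))
    (hAGD : IsGD M A AGD k) (hBGD : IsGD M B BGD k)
    (hcomm : mprod M A B = mprod M B A)
    (h1 : mprod M (mprod M AGD A) B = mprod M (mprod M B AGD) A)
    (h2 : mprod M (mprod M B BGD) AGD = mprod M (mprod M AGD B) BGD)
    (hABdag : IsMP M (mprod M A B) ABdag) :
    mprod M (mprod M (mprod M BGD AGD) (mprod M A B)) ABdag =
      mprod M (mprod M (mprod M BGD B) Bdag) (mprod M (mprod M AGD A) Adag) := by
  subst hAA hBB
  obtain ⟨ha, -, haa, -⟩ := hAdag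
  obtain ⟨hb, -, hbb, -⟩ := hBdag
  obtain ⟨-, hx, -⟩ := hAGD
  obtain ⟨-, hy, -⟩ := hBGD
  obtain ⟨hz, -, habz, -⟩ := hABdag
  apply mode3_injective hM
  replace ha := congrArg (mode3 M) ha
  replace haa := congrArg (mode3 M) haa
  replace hb := congrArg (mode3 M) hb
  replace hbb := congrArg (mode3 M) hbb
  replace hx := congrArg (mode3 M) hx
  replace hy := congrArg (mode3 M) hy
  replace hz := congrArg (mode3 M) hz
  replace habz := congrArg (mode3 M) habz
  replace hcomm := congrArg (mode3 M) hcomm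
  simp only [mode3_mprod hM, mode3_ctrans hM, mode3_mpow hM] at *
  exact reverse_order_law_of_tripotent ha haa hb hbb hcomm hx hy hz habz
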